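/- Let G be a graph on n vertices that admits a (3:1)-coloring (i.e., a proper 3-coloring). Then the temporal graph with 3 identical layers equal to the edge set of G admits a 2-activity timeline covering it with all intervals of length 0; conversely, if such a timeline exists then G is 3-colorable. -/

import Mathlib

def covers {V : Type*} {τ : ℕ} (E : Fin τ → SimpleGraph V)
    (T : Finset (V × Fin τ × Fin τ)) : Prop :=
  ∀ (t : Fin τ) (u v : V), (E t).Adj u v →
    ∃ x ∈ T, (x.1 = u ∨ x.1 = v) ∧ x.2.1 ≤ t ∧ t ≤ x.2.2

def isTimeline {V : Type*} [DecidableEq V] {τ : ℕ} (k : ℕ)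
    (T : Finset (V × Fin τ × Fin τ)) : Prop :=
  (∀ x ∈ T, x.2.1 ≤ x.2.2) ∧
  ∀ v : V, (T.filter (fun x => x.1 = v)).card ≤ k

theorem stmt7 {V : Type*} [Fintype V] [DecidableEq V] (G : SimpleGraph V) :
    (∃ c : V → Fin 3, ∀ u v, G.Adj u v → c u ≠ c v) ↔
    (∃ T : Finset (V × Fin 3 × Fin 3), isTimeline 2 T ∧
      (∀ x ∈ T, x.2.1 = x.2.2) ∧ covers (fun _ => G) T) := by
  constructor
  · rintro ⟨c, hc⟩
    refine ⟨Finset.univ.filter (fun x => x.2.1 = x.2.2 ∧ x.2.1 ≠ c x.1), ⟨?_, ?_⟩, ?_, ?_⟩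
    · intro x hx
      exact (Finset.mem_filter.1 hx).2.1.le
    · intro v
      have h : ((Finset.univ : Finset (Fin 3)).erase (c v)).card = 2 := by
        rw [Finset.card_erase_of_mem (Finset.mem_univ _)]; rfl
      rw [← h]
      apply Finset.card_le_card_of_injOn (fun x => x.2.1)
      · rintro ⟨w, a, b⟩ hx
        simp at hx ⊢
        obtain ⟨⟨h1, h2⟩, rfl⟩ := hx
        exact h2
      · rintro ⟨w, a, b⟩ hx ⟨w', a', b'⟩ hx' hab
        simp at hx hx' hab ⊢
        grind
    · intro x hx
      exact (Finset.mem_filter.1 hx).2.1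
    · intro t u v huv
      by_cases h : t = c u
      · exact ⟨(v, t, t), by simpa [h] using hc u v huv, by simp⟩
      · exact ⟨(u, t, t), by simpa using h, by simp⟩
  · rintro ⟨T, ⟨-, hT⟩, hl, hcov⟩
    have key : ∀ v, ∃ t : Fin 3, (v, t, t) ∉ T := by
      intro v
      by_contra! h
      have h3 : (Finset.univ : Finset (Fin 3)).card ≤ (T.filter (fun x => x.1 = v)).card := by
        apply Finset.card_le_card_of_injOn (fun t => (v, t, t))
        · intro t _
          simpa using h t
        · intro a _ b _ hab
          simpa using hab
      have := hT v
      simp at h3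
      omega
    choose c hc using key
    refine ⟨c, fun u v huv heq => ?_⟩
    obtain ⟨⟨w, a, b⟩, hx, hw, h1, h2⟩ := hcov (c u) u v huv
    have hab := hl _ hx
    simp only at hab hw h1 h2
    subst hab
    have ha : a = c u := le_antisymm h1 h2
    subst ha
    rcases hw with rfl | rfl
    · exact hc _ hx
    · rw [heq] at hx
      exact hc _ hx
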